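/- Fix an integer c ≥ 3. For all k ≥ 1 and p ≥ 2, N(k + p − 1, p, {1, 2c}) = N(φ_p(k + p − 1), p, {1, 6}). -/

import Mathlib

/-- The minimum excludant of a set of naturals. -/
noncomputable def mex (S : Set ℕ) : ℕ := sInf {v | v ∉ S}

/-- Fueled auxiliary for the Grundy sequence of CUT with cut-set `C`. -/
noncomputable def cutGAux (C : Finset ℕ) : ℕ → ℕ → ℕ
  | 0, _ => 0
  | fuel + 1, n =>
      mex {v | ∃ d ∈ C, ∃ l : List ℕ, l.length = d + 1 ∧ (∀ x ∈ l, 0 < x) ∧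
            l.sum = n ∧ (l.map (cutGAux C fuel)).foldr (· ^^^ ·) 0 = v}

/-- The Grundy (nim-value) sequence of the game CUT with cut-set `C`. -/
noncomputable def cutG (C : Finset ℕ) (n : ℕ) : ℕ := cutGAux C n n

/-- The nim-value of an option (a tuple of pile sizes). -/
noncomputable def nimVal (C : Finset ℕ) (l : List ℕ) : ℕ :=
  (l.map (cutG C)).foldr (· ^^^ ·) 0

/-- The nim-set `N(n, p, C)`. -/
def nimSet (n p : ℕ) (C : Finset ℕ) : Set ℕ :=
  {v | ∃ l : List ℕ, l.length = p ∧ (∀ x ∈ l, 0 < x) ∧ l.sum = n ∧ nimVal C l = v}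

/-- The map `r ↦ r'` on `1 ≤ r ≤ 2c`. -/
def rPrime (c r : ℕ) : ℕ :=
  if r = 1 then 1
  else if r = 2 then 2
  else if r = 2*c - 1 then 5
  else if r = 2*c then 6
  else if r % 2 = 1 then 3
  else 4

/-- The correspondence `φ_p`: writing `n = 2cq + r + p − 1` with `1 ≤ r ≤ 2c`,
`φ_p(n) = 6q + r' + p − 1`. -/
def phi (c p n : ℕ) : ℕ :=
  6 * ((n - p) / (2*c)) + rPrime c ((n - p) % (2*c) + 1) + p - 1

/-- The even-position value of the `j`-th block (`j < 6`) of the explicit Grundy sequence. -/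
def blockBase (j : ℕ) : ℕ :=
  if j = 0 then 0 else if j = 1 then 2 else if j = 2 then 5 else if j = 3 then 3
  else if j = 4 then 4 else 6

/-- The value, modulo the multiple of `8`, in block `j < 6` at a position of parity `b`;
`z` records whether the position is the first one of the block. -/
def blockVal (j b : ℕ) (z : Bool) : ℕ :=
  if j = 2 ∧ z = true then 1 else blockBase j ^^^ b

/-- The explicit Grundy value at pile size `x + 1` for the cut-set `{1, D}`, `D ≥ 6` even. -/
def grundy (D x : ℕ) : ℕ :=
  8 * (x / D / 6) + blockVal (x / D % 6) (x % D % 2) (decide (x % D = 0))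

/-- The nim-values of `p`-tuples of naturals summing to `m`, each entry weighted by `F`. -/
def sumSet (F : ℕ → ℕ) (p m : ℕ) : Set ℕ :=
  {v | ∃ l : List ℕ, l.length = p ∧ l.sum = m ∧ (l.map F).foldr (· ^^^ ·) 0 = v}

/-- The block index of the least sum of parity `b` that realizes the residue `w < 8`. -/
def costBlock (w b : ℕ) : ℕ :=
  if b = 0 then
    if w = 0 then 0 else if w = 1 then 2 else if w = 2 then 1 else if w = 3 then 3
    else if w = 4 then 4 else if w = 5 then 2 else if w = 6 then 5 else 3
  else
    if w = 0 then 2 else if w = 1 then 0 else if w = 2 then 3 else if w = 3 then 1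
    else if w = 4 then 2 else if w = 5 then 4 else if w = 6 then 3 else 5

/-- The position inside its block of the least sum of parity `b` that realizes `w < 8`. -/
def costOffset (w b : ℕ) : ℕ :=
  if b = 0 then if w = 5 ∨ w = 7 then 2 else 0 else 1

/-- The least sum of parity `b` over which the value `v` is realized. -/
def cost (D v b : ℕ) : ℕ :=
  D * (6 * (v / 8) + costBlock (v % 8) b) + costOffset (v % 8) b

theorem mex_eq_of {S : Set ℕ} {a : ℕ} (ha : a ∉ S) (h : ∀ v < a, v ∈ S) : mex S = a := by
  have hmem : a ∈ {v | v ∉ S} := ha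
  refine le_antisymm (Nat.sInf_le hmem) (le_csInf ⟨a, hmem⟩ fun b hb => ?_)
  by_contra hlt
  exact hb (h b (by omega))

theorem eq_zero_of_forall_pos_of_sum_eq_zero {l : List ℕ} (hl : ∀ x ∈ l, 0 < x)
    (hs : l.sum = 0) : l = [] := by
  cases l with
  | nil => rfl
  | cons a l =>
    have := hl a (by simp)
    simp at hs
    omega

theorem length_le_sum_of_pos {l : List ℕ} (hl : ∀ x ∈ l, 0 < x) : l.length ≤ l.sum := by
  induction l with
  | nil => simp
  | cons a l ih =>
    have h1 := hl a (by simp)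
    have h2 := ih fun x hx => hl x (by simp [hx])
    simp only [List.length_cons, List.sum_cons]
    omega

theorem add_length_le_sum_add_one {l : List ℕ} (hl : ∀ x ∈ l, 0 < x) {x : ℕ} (hx : x ∈ l) :
    x + l.length ≤ l.sum + 1 := by
  induction l with
  | nil => simp at hx
  | cons a l ih =>
    have h1 := hl a (by simp)
    have hl' : ∀ x ∈ l, 0 < x := fun x hx => hl x (by simp [hx])
    have h3 := length_le_sum_of_pos hl'
    simp only [List.length_cons, List.sum_cons]
    rcases List.mem_cons.1 hx with rfl | hx
    · omega
    · have h2 := ih hl' hx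
      omega

theorem cutGAux_eq_cutG {C : Finset ℕ} (hC : 0 ∉ C) (n : ℕ) :
    ∀ fuel, n ≤ fuel → cutGAux C fuel n = cutG C n := by
  induction n using Nat.strong_induction_on with
  | _ n ih =>
    intro fuel hf
    rcases Nat.eq_zero_or_pos n with rfl | hn
    · cases fuel with
      | zero => rfl
      | succ fuel =>
        rw [cutGAux]
        refine mex_eq_of ?_ fun v hv => absurd hv (Nat.not_lt_zero v)
        rintro ⟨d, -, l, hlen, hpos, hsum, -⟩
        rw [eq_zero_of_forall_pos_of_sum_eq_zero hpos hsum] at hlen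
        simp at hlen
    · have key : ∀ f, n ≤ f + 1 → cutGAux C (f + 1) n =
          mex {v | ∃ d ∈ C, ∃ l : List ℕ, l.length = d + 1 ∧ (∀ x ∈ l, 0 < x) ∧
            l.sum = n ∧ (l.map (cutG C)).foldr (· ^^^ ·) 0 = v} := by
        intro f hf
        rw [cutGAux]
        congr 1
        ext v
        simp only [Set.mem_ofPred_eq]
        refine exists_congr fun d => and_congr_right fun hd => exists_congr fun l =>
          and_congr_right fun hlen => and_congr_right fun hpos => and_congr_right fun hsum => ?_
        have : l.map (cutGAux C f) = l.map (cutG C) := by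
          refine List.map_congr_left fun x hx => ?_
          have hd0 : d ≠ 0 := fun h => hC (h ▸ hd)
          have := add_length_le_sum_add_one hpos hx
          exact ih x (by omega) f (by omega)
        rw [this]
      obtain ⟨f, rfl⟩ : ∃ f, fuel = f + 1 := ⟨fuel - 1, by omega⟩
      obtain ⟨k, rfl⟩ : ∃ k, n = k + 1 := ⟨n - 1, by omega⟩
      rw [key f hf, cutG, key k le_rfl]

theorem cutG_eq_mex {C : Finset ℕ} (hC : 0 ∉ C) (n : ℕ) :
    cutG C (n + 1) = mex {v | ∃ d ∈ C, v ∈ nimSet (n + 1) (d + 1) C} := by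
  rw [cutG, cutGAux]
  congr 1
  ext v
  simp only [Set.mem_ofPred_eq, nimSet, nimVal]
  refine exists_congr fun d => and_congr_right fun hd => exists_congr fun l =>
    and_congr_right fun hlen => and_congr_right fun hpos => and_congr_right fun hsum => ?_
  have : l.map (cutGAux C n) = l.map (cutG C) := by
    refine List.map_congr_left fun x hx => ?_
    have hd0 : d ≠ 0 := fun h => hC (h ▸ hd)
    have := add_length_le_sum_add_one hpos hx
    exact cutGAux_eq_cutG hC x n (by omega)
  rw [this]

theorem sum_map_add_one (l : List ℕ) : (l.map (· + 1)).sum = l.sum + l.length := by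
  induction l with
  | nil => rfl
  | cons a l ih => simp only [List.map_cons, List.sum_cons, List.length_cons, ih]; omega

/-- Shifting all pile sizes by one turns nim-sets into sum-sets. -/
theorem mem_nimSet_iff {C : Finset ℕ} {F : ℕ → ℕ} {n p v : ℕ}
    (hF : ∀ x, x + p ≤ n → cutG C (x + 1) = F x) :
    v ∈ nimSet n p C ↔ ∃ m, m + p = n ∧ v ∈ sumSet F p m := by
  constructor
  · rintro ⟨l, hlen, hpos, hsum, rfl⟩
    have hl : (l.map (· - 1)).map (· + 1) = l := by
      rw [List.map_map]
      conv_rhs => rw [← List.map_id l]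
      refine List.map_congr_left fun x hx => ?_
      have := hpos x hx
      simp only [Function.comp_apply, id]
      omega
    have hs := sum_map_add_one (l.map (· - 1))
    rw [hl, List.length_map] at hs
    refine ⟨(l.map (· - 1)).sum, by omega, l.map (· - 1), by simpa using hlen, rfl, ?_⟩
    rw [nimVal, List.map_map]
    congr 1
    refine List.map_congr_left fun x hx => ?_
    have h1 := hpos x hx
    have h2 := add_length_le_sum_add_one hpos hx
    rw [Function.comp_apply, ← hF (x - 1) (by omega), Nat.sub_add_cancel h1]
  · rintro ⟨m, hm, l, hlen, hsum, rfl⟩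
    refine ⟨l.map (· + 1), by simpa using hlen, by simp, by rw [sum_map_add_one]; omega, ?_⟩
    rw [nimVal, List.map_map]
    congr 1
    refine List.map_congr_left fun x hx => ?_
    have := List.le_sum_of_mem hx
    exact hF x (by omega)

theorem eight_mul_add_xor {u₁ u₂ w₁ w₂ : ℕ} (h₁ : w₁ < 8) (h₂ : w₂ < 8) :
    (8 * u₁ + w₁) ^^^ (8 * u₂ + w₂) = 8 * (u₁ ^^^ u₂) + (w₁ ^^^ w₂) := by
  have hlt : w₁ ^^^ w₂ < 2 ^ 3 := Nat.xor_lt_two_pow h₁ h₂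
  have hd : ((8 * u₁ + w₁) ^^^ (8 * u₂ + w₂)) / 2 ^ 3 = u₁ ^^^ u₂ := by
    rw [Nat.xor_div_two_pow]
    congr 1 <;> omega
  have hm : ((8 * u₁ + w₁) ^^^ (8 * u₂ + w₂)) % 2 ^ 3 = w₁ ^^^ w₂ := by
    rw [Nat.xor_mod_two_pow]
    congr 1 <;> omega
  have := Nat.div_add_mod ((8 * u₁ + w₁) ^^^ (8 * u₂ + w₂)) (2 ^ 3)
  rw [hd, hm] at this
  exact this.symm

theorem xor_le_add (a b : ℕ) : a ^^^ b ≤ a + b := by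
  induction a using Nat.strong_induction_on generalizing b with
  | _ a ih =>
    rcases Nat.eq_zero_or_pos a with rfl | ha
    · simp
    · have h1 := ih (a / 2) (by omega) (b / 2)
      have h2 : (a ^^^ b) / 2 = a / 2 ^^^ b / 2 := Nat.xor_div_two
      have h3 := Nat.xor_mod_two_eq (m := a) (n := b)
      omega

theorem mod_two_xor_mod_two (a b : ℕ) : (a % 2) ^^^ (b % 2) = (a + b) % 2 := by
  rcases Nat.mod_two_eq_zero_or_one a with h | h <;>
  rcases Nat.mod_two_eq_zero_or_one b with h' | h' <;> rw [h, h', Nat.add_mod, h, h'] <;> rfl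

theorem blockVal_lt {j b : ℕ} {z : Bool} (hb : b < 2) : blockVal j b z < 8 := by
  have h : blockBase j < 2 ^ 3 := by unfold blockBase; split_ifs <;> norm_num
  unfold blockVal
  split_ifs
  · norm_num
  · exact Nat.xor_lt_two_pow h (by omega)

theorem grundy_mul_add {D t j s : ℕ} (hj : j < 6) (hs : s < D) :
    grundy D (D * (6 * t + j) + s) = 8 * t + blockVal j (s % 2) (decide (s = 0)) := by
  have hq : (D * (6 * t + j) + s) / D = 6 * t + j := by
    rw [Nat.mul_add_div (by omega), Nat.div_eq_of_lt hs, Nat.add_zero]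
  have hr : (D * (6 * t + j) + s) % D = s := by
    rw [Nat.mul_add_mod, Nat.mod_eq_of_lt hs]
  rw [grundy, hq, hr, show (6 * t + j) / 6 = t by omega, show (6 * t + j) % 6 = j by omega]

theorem exists_block (D x : ℕ) (hD : 0 < D) :
    ∃ t j s, j < 6 ∧ s < D ∧ x = D * (6 * t + j) + s := by
  refine ⟨x / D / 6, x / D % 6, x % D, by omega, Nat.mod_lt _ hD, ?_⟩
  rw [Nat.div_add_mod (x / D) 6, Nat.div_add_mod]

/-- Positions in base `D` compare lexicographically. -/
theorem mul_add_le_mul_add_iff {D a b r s : ℕ} (hr : r < D) (hs : s < D) :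
    D * a + r ≤ D * b + s ↔ a < b ∨ a = b ∧ r ≤ s := by
  rcases lt_trichotomy a b with h | rfl | h
  · have := Nat.mul_le_mul_left D (Nat.succ_le_of_lt h)
    rw [Nat.mul_succ] at this
    omega
  · omega
  · have := Nat.mul_le_mul_left D (Nat.succ_le_of_lt h)
    rw [Nat.mul_succ] at this
    omega

theorem exists_carry {D a q S s : ℕ} (hs : s < D) (h : D * a + S = D * q + s) :
    ∃ k, S = D * k + s ∧ a + k = q := by
  refine ⟨S / D, ?_, ?_⟩
  · have h1 : S % D = s := by
      rw [← Nat.mul_add_mod D a S, h, Nat.mul_add_mod, Nat.mod_eq_of_lt hs]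
    have h2 := Nat.div_add_mod S D
    omega
  · rw [← Nat.mul_add_div (by omega : D > 0), h, Nat.mul_add_div (by omega), Nat.div_eq_of_lt hs,
      Nat.add_zero]

theorem cost_eight_mul_add {D u w b : ℕ} (hw : w < 8) :
    cost D (8 * u + w) b = D * (6 * u + costBlock w b) + costOffset w b := by
  rw [cost, show (8 * u + w) / 8 = u by omega, show (8 * u + w) % 8 = w by omega]

theorem costOffset_le (w b : ℕ) : costOffset w b ≤ 2 := by
  unfold costOffset; split_ifs <;> omega

theorem costBlock_le (w b : ℕ) : costBlock w b ≤ 5 := by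
  unfold costBlock; split_ifs <;> omega

theorem cost_small_subadd :
    ∀ w₁ < 8, ∀ w₂ < 8, ∀ b₁ < 2, ∀ b₂ < 2,
      costBlock (w₁ ^^^ w₂) ((b₁ + b₂) % 2) < costBlock w₁ b₁ + costBlock w₂ b₂ ∨
      costBlock (w₁ ^^^ w₂) ((b₁ + b₂) % 2) = costBlock w₁ b₁ + costBlock w₂ b₂ ∧
        costOffset (w₁ ^^^ w₂) ((b₁ + b₂) % 2) ≤ costOffset w₁ b₁ + costOffset w₂ b₂ := by
  decide

theorem cost_xor_le {D : ℕ} (hD : 6 ≤ D) (v₁ v₂ : ℕ) {b₁ b₂ : ℕ} (h₁ : b₁ < 2) (h₂ : b₂ < 2) :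
    cost D (v₁ ^^^ v₂) ((b₁ + b₂) % 2) ≤ cost D v₁ b₁ + cost D v₂ b₂ := by
  obtain ⟨u₁, w₁, hw₁, rfl⟩ : ∃ u w, w < 8 ∧ v₁ = 8 * u + w :=
    ⟨v₁ / 8, v₁ % 8, by omega, by omega⟩
  obtain ⟨u₂, w₂, hw₂, rfl⟩ : ∃ u w, w < 8 ∧ v₂ = 8 * u + w :=
    ⟨v₂ / 8, v₂ % 8, by omega, by omega⟩
  have hlt : w₁ ^^^ w₂ < 2 ^ 3 := Nat.xor_lt_two_pow hw₁ hw₂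
  rw [eight_mul_add_xor hw₁ hw₂, cost_eight_mul_add hlt, cost_eight_mul_add hw₁,
    cost_eight_mul_add hw₂]
  have hx := xor_le_add u₁ u₂
  have h := cost_small_subadd w₁ hw₁ w₂ hw₂ b₁ h₁ b₂ h₂
  have ho := costOffset_le (w₁ ^^^ w₂) ((b₁ + b₂) % 2)
  generalize costOffset (w₁ ^^^ w₂) ((b₁ + b₂) % 2) = o at *
  generalize costBlock (w₁ ^^^ w₂) ((b₁ + b₂) % 2) = k at *
  have hsplit : D * (6 * u₁ + costBlock w₁ b₁) + costOffset w₁ b₁ +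
      (D * (6 * u₂ + costBlock w₂ b₂) + costOffset w₂ b₂) =
      D * (6 * (u₁ + u₂) + (costBlock w₁ b₁ + costBlock w₂ b₂)) +
        (costOffset w₁ b₁ + costOffset w₂ b₂) := by ring
  rw [hsplit]
  have := costOffset_le w₁ b₁
  have := costOffset_le w₂ b₂
  rw [mul_add_le_mul_add_iff (by omega) (by omega)]
  omega

theorem cost_block_le :
    ∀ j < 6, ∀ b < 2, ∀ z : Bool, (z = true → b = 0) →
      costBlock (blockVal j b z) b = j ∧
      costOffset (blockVal j b z) b ≤ if z = true then 0 else if b = 0 then 2 else 1 := by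
  decide

theorem cost_grundy {D : ℕ} (hD : 6 ≤ D) (h2 : 2 ∣ D) (x : ℕ) :
    cost D (grundy D x) (x % 2) ≤ x ∧ x < cost D (grundy D x) (x % 2) + D := by
  obtain ⟨t, j, s, hj, hs, rfl⟩ := exists_block D x (by omega)
  have hpar : (D * (6 * t + j) + s) % 2 = s % 2 := by
    have := Dvd.dvd.mul_right h2 (6 * t + j)
    omega
  rw [hpar, grundy_mul_add hj hs, cost_eight_mul_add (blockVal_lt (by omega))]
  obtain ⟨h, h'⟩ := cost_block_le j hj (s % 2) (by omega) (decide (s = 0))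
    (by simp only [decide_eq_true_eq]; omega)
  rw [h]
  simp only [decide_eq_true_eq] at h'
  split_ifs at h' <;> omega

theorem cost_zero (D : ℕ) : cost D 0 0 = 0 := by
  simp [cost, costBlock, costOffset]

theorem cost_le_of_mem_sumSet {D : ℕ} (hD : 6 ≤ D) (h2 : 2 ∣ D) {p m v : ℕ}
    (h : v ∈ sumSet (grundy D) p m) : cost D v (m % 2) ≤ m := by
  obtain ⟨l, -, rfl, rfl⟩ := h
  induction l with
  | nil => simp [cost_zero]
  | cons a l ih =>
    simp only [List.map_cons, List.foldr_cons, List.sum_cons]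
    have h1 := cost_xor_le hD (grundy D a) ((l.map (grundy D)).foldr (· ^^^ ·) 0)
      (Nat.mod_lt a two_pos) (Nat.mod_lt l.sum two_pos)
    rw [← Nat.add_mod] at h1
    have := (cost_grundy hD h2 a).1
    omega

theorem mem_sumSet_two {F : ℕ → ℕ} {m v : ℕ} :
    v ∈ sumSet F 2 m ↔ ∃ x y, x + y = m ∧ F x ^^^ F y = v := by
  constructor
  · rintro ⟨l, hlen, rfl, rfl⟩
    obtain ⟨x, y, rfl⟩ := List.length_eq_two.1 hlen
    exact ⟨x, y, by simp, by simp⟩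
  · rintro ⟨x, y, rfl, rfl⟩
    exact ⟨[x, y], by simp⟩

theorem mem_sumSet_three {F : ℕ → ℕ} {m v : ℕ} :
    v ∈ sumSet F 3 m ↔ ∃ x y z, x + y + z = m ∧ F x ^^^ F y ^^^ F z = v := by
  constructor
  · rintro ⟨l, hlen, rfl, rfl⟩
    obtain ⟨x, y, z, rfl⟩ := List.length_eq_three.1 hlen
    exact ⟨x, y, z, by simp [Nat.add_assoc], by simp [Nat.xor_assoc]⟩
  · rintro ⟨x, y, z, rfl, rfl⟩
    exact ⟨[x, y, z], by simp [Nat.add_assoc, Nat.xor_assoc]⟩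

theorem grundy_zero (D : ℕ) : grundy D 0 = 0 := by
  simp [grundy, blockVal, blockBase]

/-- Every value is the nim-value of a pair whose sum is its cost. -/
theorem exists_pair_of_cost {D : ℕ} (hD : 6 ≤ D) (v : ℕ) {b : ℕ} (hb : b < 2) :
    ∃ x y, x + y = cost D v b ∧ grundy D x ^^^ grundy D y = v := by
  obtain ⟨u, w, hw, rfl⟩ : ∃ u w, w < 8 ∧ v = 8 * u + w := ⟨v / 8, v % 8, by omega, by omega⟩
  suffices H : ∃ j < 6, ∃ s < 3, ∃ j' < 6, ∃ s' < 2, j + j' = costBlock w b ∧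
      s + s' = costOffset w b ∧
      blockVal j (s % 2) (decide (s = 0)) ^^^ blockVal j' (s' % 2) (decide (s' = 0)) = w by
    obtain ⟨j, hj, s, hs, j', hj', s', hs', h1, h2, h3⟩ := H
    refine ⟨D * (6 * u + j) + s, D * (6 * 0 + j') + s', ?_, ?_⟩
    · rw [cost_eight_mul_add hw, ← h1, ← h2]
      ring
    · rw [grundy_mul_add hj (by omega), grundy_mul_add hj' (by omega),
        eight_mul_add_xor (blockVal_lt (by omega)) (blockVal_lt (by omega)), h3, Nat.xor_zero]
  revert w b
  decide

theorem mem_sumSet_iff_cost {D : ℕ} (hD : 6 ≤ D) (h2 : 2 ∣ D) {p m v : ℕ} (hp : 4 ≤ p) :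
    v ∈ sumSet (grundy D) p m ↔ cost D v (m % 2) ≤ m := by
  refine ⟨cost_le_of_mem_sumSet hD h2, fun h => ?_⟩
  have hb : cost D v (m % 2) % 2 = m % 2 := by
    have h3 := Dvd.dvd.mul_right h2 (6 * (v / 8) + costBlock (v % 8) (m % 2))
    have h4 : costOffset (v % 8) (m % 2) % 2 = m % 2 := by
      unfold costOffset; split_ifs <;> omega
    unfold cost
    omega
  obtain ⟨x, y, hxy, rfl⟩ := exists_pair_of_cost hD v (Nat.mod_lt m two_pos)
  obtain ⟨k, hk⟩ : ∃ k, m = x + y + k + k := ⟨(m - (x + y)) / 2, by omega⟩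
  have hz : ∀ n, ((List.replicate n 0).map (grundy D)).foldr (· ^^^ ·) 0 = 0 := by
    intro n
    induction n with
    | zero => rfl
    | succ n ih => simp only [List.replicate_succ, List.map_cons, List.foldr_cons, ih, grundy_zero,
        Nat.xor_zero]
  refine ⟨x :: y :: k :: k :: List.replicate (p - 4) 0, ?_, ?_, ?_⟩
  · simp only [List.length_cons, List.length_replicate]; omega
  · simp only [List.sum_cons, List.sum_replicate, smul_zero]; omega
  · simp only [List.map_cons, List.foldr_cons, hz, Nat.xor_zero, Nat.xor_self]

set_option synthInstance.maxSize 10000 in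
set_option synthInstance.maxHeartbeats 200000 in
set_option maxRecDepth 10000 in
theorem blockVal_xor_ne :
    ∀ j₁ < 6, ∀ j₂ < 6, ∀ e < 2, 6 ≤ j₁ + j₂ + e ∨ ∀ b₁ < 2, ∀ b₂ < 2, ∀ z₁ z₂ z : Bool,
      (z₁ = true → b₁ = 0) → (z₂ = true → b₂ = 0) → (z = true → e = 1 ∧ (b₁ + b₂) % 2 = 1) →
      blockVal j₁ b₁ z₁ ^^^ blockVal j₂ b₂ z₂ ≠
        blockVal (j₁ + j₂ + e) ((b₁ + b₂ + 1) % 2) z := by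
  decide

theorem grundy_xor_ne {D : ℕ} (hD : 6 ≤ D) (h2 : 2 ∣ D) {x y m : ℕ} (h : x + y + 1 = m) :
    grundy D x ^^^ grundy D y ≠ grundy D m := by
  obtain ⟨t₁, j₁, s₁, hj₁, hs₁, rfl⟩ := exists_block D x (by omega)
  obtain ⟨t₂, j₂, s₂, hj₂, hs₂, rfl⟩ := exists_block D y (by omega)
  obtain ⟨t, j, s, hj, hs, rfl⟩ := exists_block D m (by omega)
  rw [grundy_mul_add hj₁ hs₁, grundy_mul_add hj₂ hs₂, grundy_mul_add hj hs,
    eight_mul_add_xor (blockVal_lt (by omega)) (blockVal_lt (by omega))]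
  intro heq
  have hw : blockVal j₁ (s₁ % 2) (decide (s₁ = 0)) ^^^ blockVal j₂ (s₂ % 2) (decide (s₂ = 0))
      < 2 ^ 3 := Nat.xor_lt_two_pow (blockVal_lt (by omega)) (blockVal_lt (by omega))
  have hw' : blockVal j (s % 2) (decide (s = 0)) < 8 := blockVal_lt (by omega)
  have ht : t₁ ^^^ t₂ = t := by omega
  have hle := xor_le_add t₁ t₂
  obtain ⟨e, he, hs', hq⟩ : ∃ e < 2, s₁ + s₂ + 1 = D * e + s ∧
      6 * t₁ + j₁ + (6 * t₂ + j₂) + e = 6 * t + j := by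
    have hsum : D * (6 * t₁ + j₁ + (6 * t₂ + j₂)) + (s₁ + s₂ + 1) = D * (6 * t + j) + s := by
      rw [← h]; ring
    obtain ⟨e, hs', hq⟩ := exists_carry hs hsum
    refine ⟨e, ?_, hs', hq⟩
    by_contra he
    have := Nat.mul_le_mul_left D (not_lt.1 he)
    omega
  have hj' : j₁ + j₂ + e = j := by omega
  have hpar : s % 2 = (s₁ % 2 + s₂ % 2 + 1) % 2 := by
    have := Dvd.dvd.mul_right h2 e
    omega
  refine (blockVal_xor_ne j₁ hj₁ j₂ hj₂ e he).resolve_left (by omega) (s₁ % 2) (by omega)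
    (s₂ % 2) (by omega) (decide (s₁ = 0)) (decide (s₂ = 0)) (decide (s = 0)) ?_ ?_ ?_ ?_
  · simp only [decide_eq_true_eq]; omega
  · simp only [decide_eq_true_eq]; omega
  · simp only [decide_eq_true_eq]
    rintro rfl
    refine ⟨?_, by omega⟩
    by_contra h0
    obtain rfl : e = 0 := by omega
    omega
  · rw [hj', ← hpar]
    omega

theorem blockVal_of_ne {j b : ℕ} (hj : j ≠ 2) (z z' : Bool) : blockVal j b z = blockVal j b z' := by
  simp [blockVal, hj]

set_option synthInstance.maxSize 10000 in
set_option synthInstance.maxHeartbeats 200000 in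
set_option maxRecDepth 10000 in
theorem lt_blockVal_cases :
    ∀ j < 6, ∀ b < 2, ∀ z : Bool, (z = true → b = 0) → ∀ w < 8, blockVal j b z ≤ w ∨
      (costBlock w b + 1 < j ∨ costBlock w b + 1 = j ∧
        costOffset w b ≤ if z = true then 0 else if b = 0 then 2 else 1) ∨
      (z = false ∧ (j = 2 → b = 0) ∧ blockVal j (1 - b) false = w) ∨
      (j ≠ 0 ∧ blockVal (j - 1) 1 false ^^^ blockVal 0 b z = w) ∨
      (z = false ∧ j = 2 ∧ blockVal 1 0 true ^^^ blockVal 1 (1 - b) false = w) := by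
  decide

theorem costOffset_le_of_costBlock_eq_five :
    ∀ w < 8, ∀ b < 2, costBlock w b = 5 → costOffset w b ≤ b := by
  decide

theorem grundy_lt_cases {D : ℕ} (hD : 6 ≤ D) (h2 : 2 ∣ D) {m v : ℕ} (hv : v < grundy D m) :
    (∃ x y, x + y + 1 = m ∧ grundy D x ^^^ grundy D y = v) ∨ cost D v (m % 2) + D ≤ m := by
  obtain ⟨t, j, s, hj, hs, rfl⟩ := exists_block D m (by omega)
  obtain ⟨u, w, hw, rfl⟩ : ∃ u w, w < 8 ∧ v = 8 * u + w := ⟨v / 8, v % 8, by omega, by omega⟩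
  rw [grundy_mul_add hj hs] at hv
  have hw' : blockVal j (s % 2) (decide (s = 0)) < 8 := blockVal_lt (by omega)
  have hpar : (D * (6 * t + j) + s) % 2 = s % 2 := by
    have := Dvd.dvd.mul_right h2 (6 * t + j)
    omega
  rw [hpar, cost_eight_mul_add hw]
  have hcost : D * (6 * u + costBlock w (s % 2)) + costOffset w (s % 2) + D ≤
      D * (6 * t + j) + s ↔ 6 * u + costBlock w (s % 2) + 1 < 6 * t + j ∨
      6 * u + costBlock w (s % 2) + 1 = 6 * t + j ∧ costOffset w (s % 2) ≤ s := by
    have := costOffset_le w (s % 2)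
    rw [← mul_add_le_mul_add_iff (by omega) hs, Nat.mul_succ]
    omega
  rw [hcost]
  by_cases hu : u < t
  · right
    have h5 := costBlock_le w (s % 2)
    have ho := costOffset_le_of_costBlock_eq_five w hw (s % 2) (by omega)
    omega
  · obtain rfl : u = t := by omega
    have hwlt : w < blockVal j (s % 2) (decide (s = 0)) := by omega
    have hpair : ∀ j₁ < 6, ∀ s₁ < D, ∀ j₂ < 6, ∀ s₂ < D,
        D * (j₁ + j₂) + (s₁ + s₂ + 1) = D * j + s →
        blockVal j₁ (s₁ % 2) (decide (s₁ = 0)) ^^^ blockVal j₂ (s₂ % 2) (decide (s₂ = 0)) = w →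
        ∃ x y, x + y + 1 = D * (6 * u + j) + s ∧ grundy D x ^^^ grundy D y = 8 * u + w := by
      intro j₁ hj₁ s₁ hs₁ j₂ hj₂ s₂ hs₂ h h'
      refine ⟨D * (6 * u + j₁) + s₁, D * (6 * 0 + j₂) + s₂, ?_, ?_⟩
      · linear_combination h
      · rw [grundy_mul_add hj₁ hs₁, grundy_mul_add hj₂ hs₂,
          eight_mul_add_xor (blockVal_lt (by omega)) (blockVal_lt (by omega)), h', Nat.xor_zero]
    rcases (lt_blockVal_cases j hj (s % 2) (by omega) (decide (s = 0))
      (by simp only [decide_eq_true_eq]; omega) w hw).resolve_left (by omega) with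
      h | ⟨hz, hb, h⟩ | ⟨hj0, h⟩ | ⟨hz, rfl, h⟩
    · right
      simp only [decide_eq_true_eq] at h
      split_ifs at h <;> omega
    · left
      have hs0 : s ≠ 0 := by simpa using hz
      have hp : (s - 1) % 2 = 1 - s % 2 := by omega
      refine hpair j hj (s - 1) (by omega) 0 (by omega) 0 (by omega)
        (by rw [Nat.add_zero]; omega) ?_
      rw [hp, ← h]
      have hz' : blockVal j (1 - s % 2) (decide (s - 1 = 0)) = blockVal j (1 - s % 2) false := by
        by_cases hj2 : j = 2
        · have := hb hj2
          rw [decide_eq_false (by omega)]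
        · exact blockVal_of_ne hj2 _ _
      rw [hz']
      exact Nat.xor_zero _
    · left
      obtain ⟨i, rfl⟩ : ∃ i, j = i + 1 := ⟨j - 1, by omega⟩
      refine hpair i (by omega) (D - 1) (by omega) 0 (by omega) s hs
        (by rw [Nat.add_zero, Nat.mul_succ]; omega) ?_
      rw [show (D - 1) % 2 = 1 by omega, decide_eq_false (by omega)]
      exact h
    · left
      have hs0 : s ≠ 0 := by simpa using hz
      have hp : (s - 1) % 2 = 1 - s % 2 := by omega
      refine hpair 1 (by omega) 0 (by omega) 1 (by omega) (s - 1) (by omega) (by omega) ?_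
      rw [hp, ← h, blockVal_of_ne (by omega) (decide (s - 1 = 0)) false]
      rfl

theorem cutG_eq_grundy {D : ℕ} (hD : 6 ≤ D) (h2 : 2 ∣ D) (m : ℕ) :
    cutG {1, D} (m + 1) = grundy D m := by
  induction m using Nat.strong_induction_on with
  | _ m ih =>
    have hmem : ∀ d ≠ 0, ∀ v, v ∈ nimSet (m + 1) (d + 1) {1, D} ↔
        ∃ M, M + (d + 1) = m + 1 ∧ v ∈ sumSet (grundy D) (d + 1) M :=
      fun d hd v => mem_nimSet_iff fun x hx => ih x (by omega)
    have hpar : ∀ M, (M + D) % 2 = M % 2 := fun M => by omega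
    rw [cutG_eq_mex (by simp; omega)]
    refine mex_eq_of ?_ fun v hv => ?_
    · rintro ⟨d, hd, hv⟩
      rw [hmem d (by rintro rfl; simp at hd; omega)] at hv
      obtain ⟨M, hM, hv⟩ := hv
      rcases Finset.mem_insert.1 hd with rfl | hd
      · obtain ⟨x, y, hxy, hv⟩ := mem_sumSet_two.1 hv
        exact grundy_xor_ne hD h2 (by omega) hv
      · obtain rfl := Finset.mem_singleton.1 hd
        obtain rfl : m = M + d := by omega
        have h1 := cost_le_of_mem_sumSet hD h2 hv
        have h3 := (cost_grundy hD h2 (M + d)).2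
        rw [hpar] at h3
        omega
    · rcases grundy_lt_cases hD h2 hv with ⟨x, y, hxy, hv⟩ | h
      · exact ⟨1, by simp, (hmem 1 one_ne_zero v).2
          ⟨x + y, by omega, mem_sumSet_two.2 ⟨x, y, rfl, hv⟩⟩⟩
      · obtain ⟨M, rfl⟩ : ∃ M, m = M + D := ⟨m - D, by omega⟩
        rw [hpar] at h
        exact ⟨D, by simp, (hmem D (by omega) v).2
          ⟨M, by omega, (mem_sumSet_iff_cost hD h2 (by omega)).2 (by omega)⟩⟩

/-- The part of the value in block `q` that does not depend on the parity of the position;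
`z` records whether the position is the first one of the block. -/
def lead (q : ℕ) (z : Bool) : ℕ :=
  8 * (q / 6) + blockBase (q % 6) ^^^ (if q % 6 = 2 ∧ z = true then 4 else 0)

theorem lead_of_ne {q : ℕ} (hq : q % 6 ≠ 2) (z z' : Bool) : lead q z = lead q z' := by
  simp [lead, hq]

theorem grundy_eq_lead_xor {D q s : ℕ} (hs : s < D) :
    grundy D (D * q + s) = lead q (decide (s = 0)) ^^^ (s % 2) := by
  have hb : blockBase (q % 6) < 8 := by unfold blockBase; split_ifs <;> norm_num
  have h := grundy_mul_add (t := q / 6) (j := q % 6) (by omega) hs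
  rw [Nat.div_add_mod] at h
  rw [h, lead, blockVal]
  split_ifs with hz
  · obtain rfl : s = 0 := by simpa using hz.2
    have := eight_mul_add_xor (u₁ := q / 6) (u₂ := 0) (w₁ := 5) (w₂ := 4)
      (by norm_num) (by norm_num)
    simpa [blockBase, hz.1] using this.symm
  · have := eight_mul_add_xor (u₁ := q / 6) (u₂ := 0) (w₂ := s % 2) hb (by omega)
    simpa using this.symm

theorem lead_pred_xor_lead_pred {q₁ q₂ : ℕ} (h₁ : q₁ % 6 = 1) (h₂ : q₂ % 6 = 1) :
    lead q₁ false ^^^ lead q₂ false = lead (q₁ + 1) false ^^^ lead (q₂ + 1) false := by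
  have e₁ : (q₁ + 1) / 6 = q₁ / 6 := by omega
  have e₂ : (q₂ + 1) / 6 = q₂ / 6 := by omega
  have m₁ : (q₁ + 1) % 6 = 2 := by omega
  have m₂ : (q₂ + 1) % 6 = 2 := by omega
  have hl : lead q₁ false ^^^ lead q₂ false = 8 * (q₁ / 6 ^^^ q₂ / 6) + (2 ^^^ 2) := by
    rw [← eight_mul_add_xor (by norm_num) (by norm_num)]
    simp [lead, h₁, h₂, blockBase]
  have hr : lead (q₁ + 1) false ^^^ lead (q₂ + 1) false =
      8 * (q₁ / 6 ^^^ q₂ / 6) + (5 ^^^ 5) := by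
    rw [← eight_mul_add_xor (by norm_num) (by norm_num)]
    simp [lead, m₁, m₂, e₁, e₂, blockBase]
  rw [hl, hr, Nat.xor_self, Nat.xor_self]

theorem grundy_xor_two {D q₁ q₂ s₁ s₂ : ℕ} (h₁ : s₁ < D) (h₂ : s₂ < D) :
    grundy D (D * q₁ + s₁) ^^^ grundy D (D * q₂ + s₂) =
      lead q₁ (decide (s₁ = 0)) ^^^ lead q₂ (decide (s₂ = 0)) ^^^ ((s₁ + s₂) % 2) := by
  rw [grundy_eq_lead_xor h₁, grundy_eq_lead_xor h₂, ← mod_two_xor_mod_two]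
  ac_rfl

theorem grundy_xor_three {D q₁ q₂ q₃ s₁ s₂ s₃ : ℕ} (h₁ : s₁ < D) (h₂ : s₂ < D) (h₃ : s₃ < D) :
    grundy D (D * q₁ + s₁) ^^^ grundy D (D * q₂ + s₂) ^^^ grundy D (D * q₃ + s₃) =
      lead q₁ (decide (s₁ = 0)) ^^^ lead q₂ (decide (s₂ = 0)) ^^^ lead q₃ (decide (s₃ = 0)) ^^^
        ((s₁ + s₂ + s₃) % 2) := by
  rw [grundy_xor_two h₁ h₂, grundy_eq_lead_xor h₃, ← mod_two_xor_mod_two (s₁ + s₂)]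
  ac_rfl

/-- Two positions, in blocks of lengths `D` and `D'`, that play the same role. -/
structure SameRole (D D' s s' : ℕ) : Prop where
  lt : s < D
  lt' : s' < D'
  parity : s % 2 = s' % 2
  zero : s = 0 ↔ s' = 0
  one : s = 1 ↔ s' = 1
  penultimate : s = D - 2 ↔ s' = D' - 2
  last : s = D - 1 ↔ s' = D' - 1

theorem SameRole.symm {D D' s s' : ℕ} (h : SameRole D D' s s') : SameRole D' D s' s :=
  ⟨h.lt', h.lt, h.parity.symm, h.zero.symm, h.one.symm, h.penultimate.symm, h.last.symm⟩

theorem SameRole.exists_two {D D' s s' s₁ s₂ k : ℕ} (h : SameRole D D' s s') (hD : 6 ≤ D)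
    (hD' : 6 ≤ D') (h₁ : s₁ < D) (h₂ : s₂ < D) (hs : s₁ + s₂ = D * k + s) :
    ∃ s₁' < D', ∃ s₂' < D', s₁' + s₂' = D' * k + s' ∧ (s₁ = 0 ↔ s₁' = 0) ∧
      (s₂ = 0 ↔ s₂' = 0) := by
  obtain ⟨h1, h2, h3, h4, h5, h6, h7⟩ := h
  have hk : k < 2 := by
    by_contra hk
    have := Nat.mul_le_mul_left D (not_lt.1 hk)
    omega
  interval_cases k
  · by_cases z₁ : s₁ = 0
    · exact ⟨0, by omega, s', h2, by omega, by omega, by omega⟩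
    by_cases z₂ : s₂ = 0
    · exact ⟨s', h2, 0, by omega, by omega, by omega, by omega⟩
    exact ⟨1, by omega, s' - 1, by omega, by omega, by omega, by omega⟩
  · exact ⟨D' - 1, by omega, s' + 1, by omega, by omega, by omega, by omega⟩

theorem SameRole.exists_three {D D' s s' s₁ s₂ s₃ k : ℕ} (h : SameRole D D' s s') (hD : 6 ≤ D)
    (hD' : 6 ≤ D') (h₁ : s₁ < D) (h₂ : s₂ < D) (h₃ : s₃ < D) (hs : s₁ + s₂ + s₃ = D * k + s)
    (hk : k = 0 → s' = 2 → s₁ = 0 ∨ s₂ = 0 ∨ s₃ = 0) :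
    ∃ s₁' < D', ∃ s₂' < D', ∃ s₃' < D', s₁' + s₂' + s₃' = D' * k + s' ∧ (s₁ = 0 ↔ s₁' = 0) ∧
      (s₂ = 0 ↔ s₂' = 0) ∧ (s₃ = 0 ↔ s₃' = 0) := by
  by_cases z₁ : s₁ = 0
  · obtain ⟨a, ha, b, hb, hab, za, zb⟩ := h.exists_two hD hD' h₂ h₃ (k := k) (by omega)
    exact ⟨0, by omega, a, ha, b, hb, by omega, by omega, za, zb⟩
  by_cases z₂ : s₂ = 0
  · obtain ⟨a, ha, b, hb, hab, za, zb⟩ := h.exists_two hD hD' h₁ h₃ (k := k) (by omega)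
    exact ⟨a, ha, 0, by omega, b, hb, by omega, za, by omega, zb⟩
  by_cases z₃ : s₃ = 0
  · obtain ⟨a, ha, b, hb, hab, za, zb⟩ := h.exists_two hD hD' h₁ h₂ (k := k) (by omega)
    exact ⟨a, ha, b, hb, 0, by omega, by omega, za, zb, by omega⟩
  obtain ⟨h1, h2, h3, h4, h5, h6, h7⟩ := h
  have hk3 : k < 3 := by
    by_contra hk
    have := Nat.mul_le_mul_left D (not_lt.1 hk)
    omega
  interval_cases k
  · exact ⟨1, by omega, 1, by omega, s' - 2, by omega, by omega, by omega, by omega, by omega⟩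
  · by_cases hs' : s' = 0
    · exact ⟨D' - 2, by omega, 1, by omega, 1, by omega, by omega, by omega, by omega, by omega⟩
    · exact ⟨D' - 1, by omega, s', by omega, 1, by omega, by omega, by omega, by omega, by omega⟩
  · exact ⟨D' - 1, by omega, D' - 1, by omega, s' + 2, by omega, by omega, by omega, by omega,
      by omega⟩

theorem SameRole.mem_sumSet_two {D D' s s' q v : ℕ} (h : SameRole D D' s s') (hD : 6 ≤ D)
    (hD' : 6 ≤ D') (h2 : 2 ∣ D) (h2' : 2 ∣ D') (hv : v ∈ sumSet (grundy D) 2 (D * q + s)) :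
    v ∈ sumSet (grundy D') 2 (D' * q + s') := by
  obtain ⟨x, y, hxy, rfl⟩ := _root_.mem_sumSet_two.1 hv
  rw [← Nat.div_add_mod x D, ← Nat.div_add_mod y D] at hxy ⊢
  have h₁ := Nat.mod_lt x (show D > 0 by omega)
  have h₂ := Nat.mod_lt y (show D > 0 by omega)
  generalize x % D = s₁ at *
  generalize y % D = s₂ at *
  generalize x / D = q₁ at *
  generalize y / D = q₂ at *
  obtain ⟨k, hk, rfl⟩ := exists_carry (a := q₁ + q₂) (S := s₁ + s₂) h.lt (by rw [← hxy]; ring)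
  obtain ⟨s₁', h₁', s₂', h₂', hsum, z₁, z₂⟩ := h.exists_two hD hD' h₁ h₂ hk
  refine _root_.mem_sumSet_two.2 ⟨D' * q₁ + s₁', D' * q₂ + s₂', by linear_combination hsum, ?_⟩
  have hpar : (s₁ + s₂) % 2 = (s₁' + s₂') % 2 := by
    have := Dvd.dvd.mul_right h2 k
    have := Dvd.dvd.mul_right h2' k
    have := h.parity
    omega
  simp only [grundy_xor_two h₁ h₂, grundy_xor_two h₁' h₂', z₁, z₂, hpar]

theorem SameRole.mem_sumSet_three {D D' s s' q v : ℕ} (h : SameRole D D' s s') (hD : 6 ≤ D)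
    (hD' : 6 ≤ D') (h2 : 2 ∣ D) (h2' : 2 ∣ D') (hv : v ∈ sumSet (grundy D) 3 (D * q + s)) :
    v ∈ sumSet (grundy D') 3 (D' * q + s') := by
  obtain ⟨x, y, z, hxyz, rfl⟩ := _root_.mem_sumSet_three.1 hv
  rw [← Nat.div_add_mod x D, ← Nat.div_add_mod y D, ← Nat.div_add_mod z D] at hxyz ⊢
  have h₁ := Nat.mod_lt x (show D > 0 by omega)
  have h₂ := Nat.mod_lt y (show D > 0 by omega)
  have h₃ := Nat.mod_lt z (show D > 0 by omega)
  generalize x % D = s₁ at *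
  generalize y % D = s₂ at *
  generalize z % D = s₃ at *
  generalize x / D = q₁ at *
  generalize y / D = q₂ at *
  generalize z / D = q₃ at *
  obtain ⟨k, hk, rfl⟩ := exists_carry (a := q₁ + q₂ + q₃) (S := s₁ + s₂ + s₃) h.lt
    (by rw [← hxyz]; ring)
  have hpar : (s₁ + s₂ + s₃) % 2 = s' % 2 := by
    have := Dvd.dvd.mul_right h2 k
    have := h.parity
    omega
  rw [grundy_xor_three h₁ h₂ h₃, hpar]
  suffices H : ∃ p₁ p₂ p₃ l, p₁ + p₂ + p₃ + l = q₁ + q₂ + q₃ + k ∧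
      ∃ r₁ < D', ∃ r₂ < D', ∃ r₃ < D', r₁ + r₂ + r₃ = D' * l + s' ∧
        lead p₁ (decide (r₁ = 0)) ^^^ lead p₂ (decide (r₂ = 0)) ^^^ lead p₃ (decide (r₃ = 0)) =
        lead q₁ (decide (s₁ = 0)) ^^^ lead q₂ (decide (s₂ = 0)) ^^^ lead q₃ (decide (s₃ = 0)) by
    obtain ⟨p₁, p₂, p₃, l, hl, r₁, hr₁, r₂, hr₂, r₃, hr₃, hsum, hlead⟩ := H
    refine _root_.mem_sumSet_three.2 ⟨D' * p₁ + r₁, D' * p₂ + r₂, D' * p₃ + r₃, ?_, ?_⟩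
    · rw [← hl]
      linear_combination hsum
    · have hpar' : (r₁ + r₂ + r₃) % 2 = s' % 2 := by
        have := Dvd.dvd.mul_right h2' l
        omega
      rw [grundy_xor_three hr₁ hr₂ hr₃, hlead, hpar']
  by_cases hex : k = 0 → s' = 2 → s₁ = 0 ∨ s₂ = 0 ∨ s₃ = 0
  · obtain ⟨r₁, hr₁, r₂, hr₂, r₃, hr₃, hsum, z₁, z₂, z₃⟩ :=
      h.exists_three hD hD' h₁ h₂ h₃ hk hex
    exact ⟨q₁, q₂, q₃, k, rfl, r₁, hr₁, r₂, hr₂, r₃, hr₃, hsum, by simp only [z₁, z₂, z₃]⟩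
  · push Not at hex
    obtain ⟨rfl, rfl, z₁, z₂, z₃⟩ := hex
    simp only [z₁, z₂, z₃, decide_false]
    by_cases e₁ : q₁ % 6 = 2
    · by_cases e₂ : q₂ % 6 = 2
      · by_cases e₃ : q₃ % 6 = 2
        · obtain ⟨p₂, rfl⟩ : ∃ p, q₂ = p + 1 := ⟨q₂ - 1, by omega⟩
          obtain ⟨p₃, rfl⟩ : ∃ p, q₃ = p + 1 := ⟨q₃ - 1, by omega⟩
          refine ⟨q₁, p₂, p₃, 2, by omega, D' - 1, by omega, D' - 1, by omega, 4, by omega,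
            by omega, ?_⟩
          rw [decide_eq_false (by omega : ¬ D' - 1 = 0), Nat.xor_assoc, Nat.xor_assoc,
            ← lead_pred_xor_lead_pred (by omega) (by omega)]
          rfl
        · exact ⟨q₁, q₂, q₃, 0, rfl, 1, by omega, 1, by omega, 0, by omega, by omega,
            by rw [lead_of_ne e₃ _ false]; rfl⟩
      · exact ⟨q₁, q₂, q₃, 0, rfl, 1, by omega, 0, by omega, 1, by omega, by omega,
          by rw [lead_of_ne e₂ _ false]; rfl⟩
    · exact ⟨q₁, q₂, q₃, 0, rfl, 0, by omega, 1, by omega, 1, by omega, by omega,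
        by rw [lead_of_ne e₁ _ false]; rfl⟩

theorem SameRole.mem_sumSet {D D' s s' p q v : ℕ} (h : SameRole D D' s s') (hD : 6 ≤ D)
    (hD' : 6 ≤ D') (h2 : 2 ∣ D) (h2' : 2 ∣ D') (hp : 2 ≤ p)
    (hv : v ∈ sumSet (grundy D) p (D * q + s)) : v ∈ sumSet (grundy D') p (D' * q + s') := by
  obtain rfl | rfl | hp : p = 2 ∨ p = 3 ∨ 4 ≤ p := by omega
  · exact h.mem_sumSet_two hD hD' h2 h2' hv
  · exact h.mem_sumSet_three hD hD' h2 h2' hv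
  · rw [mem_sumSet_iff_cost hD' h2' hp]
    rw [mem_sumSet_iff_cost hD h2 hp] at hv
    obtain ⟨h1, h1', h3, h4, h5, h6, h7⟩ := h
    have e : (D * q + s) % 2 = s % 2 := by
      have := Dvd.dvd.mul_right h2 q
      omega
    have e' : (D' * q + s') % 2 = s % 2 := by
      have := Dvd.dvd.mul_right h2' q
      omega
    rw [e] at hv
    rw [e']
    have ho := costOffset_le (v % 8) (s % 2)
    have hpar : costOffset (v % 8) (s % 2) % 2 = s % 2 := by
      unfold costOffset; split_ifs <;> omega
    unfold cost at hv ⊢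
    rw [mul_add_le_mul_add_iff (by omega) (by omega)] at hv ⊢
    omega

theorem sameRole_rPrime {c s : ℕ} (hc : 3 ≤ c) (hs : s < 2 * c) :
    SameRole (2 * c) 6 s (rPrime c (s + 1) - 1) := by
  generalize hr : rPrime c (s + 1) = r
  unfold rPrime at hr
  split_ifs at hr <;> constructor <;> omega

theorem nimSet_eq_sumSet {D : ℕ} (hD : 6 ≤ D) (h2 : 2 ∣ D) (m p : ℕ) :
    nimSet (m + p) p {1, D} = sumSet (grundy D) p m := by
  ext v
  rw [mem_nimSet_iff fun x _ => cutG_eq_grundy hD h2 x]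
  constructor
  · rintro ⟨M, hM, hv⟩
    obtain rfl : M = m := by omega
    exact hv
  · exact fun hv => ⟨m, rfl, hv⟩

/-- For `c ≥ 3`, `k ≥ 1` and `p ≥ 2`,
`N(k + p − 1, p, {1, 2c}) = N(φ_p(k + p − 1), p, {1, 6})`. -/
theorem nimSet_phi_correspondence (c : ℕ) (hc : 3 ≤ c) (k : ℕ) (hk : 1 ≤ k)
    (p : ℕ) (hp : 2 ≤ p) :
    nimSet (k + p - 1) p {1, 2*c} = nimSet (phi c p (k + p - 1)) p {1, 6} := by
  obtain ⟨m, rfl⟩ : ∃ m, k = m + 1 := ⟨k - 1, by omega⟩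
  have hrole := sameRole_rPrime hc (Nat.mod_lt m (show 2 * c > 0 by omega))
  have hpos : 0 < rPrime c (m % (2 * c) + 1) := by unfold rPrime; split_ifs <;> norm_num
  have hphi : phi c p (m + 1 + p - 1) =
      6 * (m / (2 * c)) + (rPrime c (m % (2 * c) + 1) - 1) + p := by
    rw [phi, show m + 1 + p - 1 - p = m by omega]
    omega
  rw [hphi, show m + 1 + p - 1 = m + p by omega, nimSet_eq_sumSet (by omega) (by omega),
    nimSet_eq_sumSet (by omega) (by omega)]
  conv_lhs => rw [← Nat.div_add_mod m (2 * c)]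
  ext v
  exact ⟨hrole.mem_sumSet (by omega) (by omega) (by omega) (by omega) hp,
    hrole.symm.mem_sumSet (by omega) (by omega) (by omega) (by omega) hp⟩
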